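/- Let L be a Lie superalgebra over a field of characteristic ≠ 2, 3 and let N be a graded ideal of L contained in L² ∩ Z(L). Then the sequence N ⊗ L → L ⊗ L → (L/N) ⊗ (L/N) → 0 of non-abelian tensor products is exact, where the first map is induced by the inclusion N ↪ L and the second by the projection L → L/N. -/

import Mathlib

open Module Function TensorProduct

universe u v w x y z

/-- The sign `(-1)^(ab)` for degrees `a b : ZMod 2`, as an element of the field `F`. -/
def sgn (F : Type u) [Field F] (a b : ZMod 2) : F :=
  if a = 1 ∧ b = 1 then -1 else 1

/-- A supermodule (ℤ/2-graded vector space) over `F`. -/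
class SuperModule (F : Type u) (V : Type v) [Field F] [AddCommGroup V] [Module F V] where
  grade : ZMod 2 → Submodule F V
  isCompl_grade : IsCompl (grade 0) (grade 1)

/-- The graded piece of degree `a`. -/
abbrev gr (F : Type u) (V : Type v) [Field F] [AddCommGroup V] [Module F V]
    [s : SuperModule F V] (a : ZMod 2) : Submodule F V := s.grade a

/-- A Lie superalgebra structure on a supermodule. -/
class LieSuperAlgebra (F : Type u) (L : Type v) [Field F] [AddCommGroup L] [Module F L]
    [SuperModule F L] where
  bracket : L →ₗ[F] L →ₗ[F] L
  bracket_grade : ∀ (a b : ZMod 2) (x y : L), x ∈ gr F L a → y ∈ gr F L b →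
    bracket x y ∈ gr F L (a + b)
  skew : ∀ (a b : ZMod 2) (x y : L), x ∈ gr F L a → y ∈ gr F L b →
    bracket x y = -(sgn F a b) • bracket y x
  jacobi : ∀ (a b c : ZMod 2) (x y zz : L), x ∈ gr F L a → y ∈ gr F L b → zz ∈ gr F L c →
    sgn F a c • bracket x (bracket y zz) + sgn F b a • bracket y (bracket zz x)
      + sgn F c b • bracket zz (bracket x y) = 0

/-- The bracket of a Lie superalgebra. -/
abbrev br (F : Type u) (L : Type v) [Field F] [AddCommGroup L] [Module F L] [SuperModule F L]
    [s : LieSuperAlgebra F L] : L →ₗ[F] L →ₗ[F] L := s.bracket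

/-- A graded submodule. -/
def IsGradedSub (F : Type u) {V : Type v} [Field F] [AddCommGroup V] [Module F V]
    [SuperModule F V] (N : Submodule F V) : Prop :=
  N ≤ (N ⊓ gr F V 0) ⊔ (N ⊓ gr F V 1)

section LSADefs

variable (F : Type u) [Field F]
variable (L : Type v) [AddCommGroup L] [Module F L] [SuperModule F L] [LieSuperAlgebra F L]

/-- The derived subalgebra `L² = [L, L]`. -/
def derivedSub : Submodule F L := Submodule.span F {t | ∃ x y : L, br F L x y = t}

/-- The center `Z(L)`. -/
def centerSub : Submodule F L := ⨅ x : L, LinearMap.ker ((br F L).flip x)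

/-- The span of brackets `[A, B]` of two submodules. -/
def bracketSub (A B : Submodule F L) : Submodule F L :=
  Submodule.span F {t | ∃ x ∈ A, ∃ y ∈ B, br F L x y = t}

/-- Abelian Lie superalgebra. -/
def IsAbelianLSA : Prop := ∀ x y : L, br F L x y = 0

/-- The lower central series. -/
def lcs : ℕ → Submodule F L
  | 0 => ⊤
  | n + 1 => Submodule.span F {t | ∃ x : L, ∃ y ∈ lcs n, br F L x y = t}

/-- Nilpotent Lie superalgebra. -/
def IsNilpotentLSA : Prop := ∃ n : ℕ, lcs F L n = ⊥

end LSADefs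

/-- Homomorphism of Lie superalgebras: an even linear map preserving grading and bracket. -/
structure LieSuperHom (F : Type u) (L : Type v) (M : Type w) [Field F]
    [AddCommGroup L] [Module F L] [SuperModule F L] [LieSuperAlgebra F L]
    [AddCommGroup M] [Module F M] [SuperModule F M] [LieSuperAlgebra F M]
    extends L →ₗ[F] M where
  map_grade : ∀ (a : ZMod 2) (x : L), x ∈ gr F L a → toLinearMap x ∈ gr F M a
  map_bracket : ∀ x y : L, toLinearMap (br F L x y) = br F M (toLinearMap x) (toLinearMap y)

/-- Isomorphism of Lie superalgebras. -/
def LSAIsomorphic (F : Type u) (L : Type v) (M : Type w) [Field F]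
    [AddCommGroup L] [Module F L] [SuperModule F L] [LieSuperAlgebra F L]
    [AddCommGroup M] [Module F M] [SuperModule F M] [LieSuperAlgebra F M] : Prop :=
  ∃ f : LieSuperHom F L M, Function.Bijective f.toLinearMap

/-- `Q` is (a realization of) the quotient `L / L²`, i.e. the abelianization of `L`. -/
def IsQuotientByDerived (F : Type u) (L : Type v) (Q : Type w) [Field F]
    [AddCommGroup L] [Module F L] [SuperModule F L] [LieSuperAlgebra F L]
    [AddCommGroup Q] [Module F Q] [SuperModule F Q] [LieSuperAlgebra F Q] : Prop :=
  ∃ f : LieSuperHom F L Q, Function.Surjective f.toLinearMap ∧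
    LinearMap.ker f.toLinearMap = derivedSub F L

/-- An action of the Lie superalgebra `P` on the Lie superalgebra `M`. -/
structure LieSuperAction (F : Type u) (P : Type v) (M : Type w) [Field F]
    [AddCommGroup P] [Module F P] [SuperModule F P] [LieSuperAlgebra F P]
    [AddCommGroup M] [Module F M] [SuperModule F M] [LieSuperAlgebra F M] where
  act : P →ₗ[F] M →ₗ[F] M
  act_grade : ∀ (a b : ZMod 2) (p : P) (m : M), p ∈ gr F P a → m ∈ gr F M b →
    act p m ∈ gr F M (a + b)
  act_bracket : ∀ (a b : ZMod 2) (p p' : P) (m : M), p ∈ gr F P a → p' ∈ gr F P b →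
    act (br F P p p') m = act p (act p' m) - sgn F a b • act p' (act p m)
  act_lie : ∀ (a b : ZMod 2) (p : P) (m m' : M), p ∈ gr F P a → m ∈ gr F M b →
    act p (br F M m m') = br F M (act p m) m' + sgn F a b • br F M m (act p m')

/-- A trivial action. -/
def LieSuperAction.IsTrivial {F : Type u} {P : Type v} {M : Type w} [Field F]
    [AddCommGroup P] [Module F P] [SuperModule F P] [LieSuperAlgebra F P]
    [AddCommGroup M] [Module F M] [SuperModule F M] [LieSuperAlgebra F M]
    (α : LieSuperAction F P M) : Prop := ∀ (p : P) (m : M), α.act p m = 0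

/-- The trivial action of `P` on `M`. -/
def trivialAction (F : Type u) (P : Type v) (M : Type w) [Field F]
    [AddCommGroup P] [Module F P] [SuperModule F P] [LieSuperAlgebra F P]
    [AddCommGroup M] [Module F M] [SuperModule F M] [LieSuperAlgebra F M] :
    LieSuperAction F P M where
  act := 0
  act_grade := by
    intro a b p m _ _
    simp only [LinearMap.zero_apply]
    exact (gr F M (a + b)).zero_mem
  act_bracket := by intro a b p p' m _ _; simp
  act_lie := by intro a b p m m' _ _; simp

/-- A Lie superpairing on `M × N` (relative to mutual actions) with values in the
Lie superalgebra `T`; these are exactly the defining relations of the non-abelian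
tensor product `M ⊗ N`. -/
structure SuperPairing (F : Type u) (M : Type v) (N : Type w) (T : Type x) [Field F]
    [AddCommGroup M] [Module F M] [SuperModule F M] [LieSuperAlgebra F M]
    [AddCommGroup N] [Module F N] [SuperModule F N] [LieSuperAlgebra F N]
    [AddCommGroup T] [Module F T] [SuperModule F T] [LieSuperAlgebra F T]
    (α : LieSuperAction F M N) (β : LieSuperAction F N M) where
  pair : M →ₗ[F] N →ₗ[F] T
  pair_grade : ∀ (a b : ZMod 2) (m : M) (n : N), m ∈ gr F M a → n ∈ gr F N b →
    pair m n ∈ gr F T (a + b)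
  rel1 : ∀ (a b : ZMod 2) (m m' : M) (n : N), m ∈ gr F M a → m' ∈ gr F M b →
    pair (br F M m m') n = pair m (α.act m' n) - sgn F a b • pair m' (α.act m n)
  rel2 : ∀ (a b c : ZMod 2) (m : M) (n n' : N), m ∈ gr F M a → n ∈ gr F N b → n' ∈ gr F N c →
    pair m (br F N n n') = sgn F c (a + b) • pair (β.act n' m) n - sgn F a b • pair (β.act n m) n'
  rel3 : ∀ (a b : ZMod 2) (m : M) (n : N) (m' : M) (n' : N), m ∈ gr F M a → n ∈ gr F N b →
    br F T (pair m n) (pair m' n') = - sgn F a b • pair (β.act n m) (α.act m' n')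

/-- `T`, together with the pairing `p`, is (a realization of) the non-abelian tensor
product `M ⊗ N`: it satisfies the universal property among Lie superpairings. -/
def IsTensorProductLSA (F : Type u) (M : Type v) (N : Type w) (T : Type x) [Field F]
    [AddCommGroup M] [Module F M] [SuperModule F M] [LieSuperAlgebra F M]
    [AddCommGroup N] [Module F N] [SuperModule F N] [LieSuperAlgebra F N]
    [AddCommGroup T] [Module F T] [SuperModule F T] [LieSuperAlgebra F T]
    (α : LieSuperAction F M N) (β : LieSuperAction F N M)
    (p : SuperPairing F M N T α β) : Prop :=
  ∀ (T' : Type (max u v w x)) [AddCommGroup T'] [Module F T'] [SuperModule F T']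
    [LieSuperAlgebra F T'] (q : SuperPairing F M N T' α β),
    ∃! h : LieSuperHom F T T', ∀ (m : M) (n : N), h.toLinearMap (p.pair m n) = q.pair m n

/-- A Lie superpairing for the tensor square `L ⊗ L` (with adjoint actions):
the defining relations of the non-abelian tensor square. -/
structure TensorSqPairing (F : Type u) (L : Type v) (T : Type w) [Field F]
    [AddCommGroup L] [Module F L] [SuperModule F L] [LieSuperAlgebra F L]
    [AddCommGroup T] [Module F T] [SuperModule F T] [LieSuperAlgebra F T] where
  pair : L →ₗ[F] L →ₗ[F] T
  pair_grade : ∀ (a b : ZMod 2) (x y : L), x ∈ gr F L a → y ∈ gr F L b →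
    pair x y ∈ gr F T (a + b)
  rel1 : ∀ (a b : ZMod 2) (x x' y : L), x ∈ gr F L a → x' ∈ gr F L b →
    pair (br F L x x') y = pair x (br F L x' y) - sgn F a b • pair x' (br F L x y)
  rel2 : ∀ (a b c : ZMod 2) (x y y' : L), x ∈ gr F L a → y ∈ gr F L b → y' ∈ gr F L c →
    pair x (br F L y y') = sgn F c (a + b) • pair (br F L y' x) y
      - sgn F a b • pair (br F L y x) y'
  rel3 : ∀ (a b : ZMod 2) (x y x' y' : L), x ∈ gr F L a → y ∈ gr F L b →
    br F T (pair x y) (pair x' y') = - sgn F a b • pair (br F L y x) (br F L x' y')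

/-- `T`, together with the pairing `p`, is (a realization of) the non-abelian tensor
square `L ⊗ L`. -/
def IsTensorSquare (F : Type u) (L : Type v) (T : Type w) [Field F]
    [AddCommGroup L] [Module F L] [SuperModule F L] [LieSuperAlgebra F L]
    [AddCommGroup T] [Module F T] [SuperModule F T] [LieSuperAlgebra F T]
    (p : TensorSqPairing F L T) : Prop :=
  ∀ (T' : Type (max u v w)) [AddCommGroup T'] [Module F T'] [SuperModule F T']
    [LieSuperAlgebra F T'] (q : TensorSqPairing F L T'),
    ∃! h : LieSuperHom F T T', ∀ x y : L, h.toLinearMap (p.pair x y) = q.pair x y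

/-- The submodule `L □ L` of a realization `T` of `L ⊗ L`, generated by the elements
`x ⊗ x' + (-1)^{|x||x'|} (x' ⊗ x)` (homogeneous `x, x'`) and `x₀ ⊗ x₀` (`x₀` even). -/
def squareBox (F : Type u) (L : Type v) (T : Type w) [Field F]
    [AddCommGroup L] [Module F L] [SuperModule F L] [LieSuperAlgebra F L]
    [AddCommGroup T] [Module F T] [SuperModule F T] [LieSuperAlgebra F T]
    (p : TensorSqPairing F L T) : Submodule F T :=
  Submodule.span F
    ({t | ∃ (a b : ZMod 2) (x y : L), x ∈ gr F L a ∧ y ∈ gr F L b ∧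
        t = p.pair x y + sgn F a b • p.pair y x} ∪
      {t | ∃ x ∈ gr F L 0, t = p.pair x x})

/-- Data of a "universal quadratic functor" target: maps satisfying the defining
relations of `Γ(V)`. -/
structure GammaData (F : Type u) (V : Type v) (W : Type w) [Field F]
    [AddCommGroup V] [Module F V] [SuperModule F V] [AddCommGroup W] [Module F W] where
  gam : V → W
  bil : V →ₗ[F] V →ₗ[F] W
  gam_smul : ∀ (c : F) (v : V), v ∈ gr F V 0 → gam (c • v) = (c * c) • gam v
  gam_add : ∀ v w' : V, v ∈ gr F V 0 → w' ∈ gr F V 0 →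
    gam (v + w') - gam v - gam w' = bil v w'
  bil_symm : ∀ (a b : ZMod 2) (v w' : V), v ∈ gr F V a → w' ∈ gr F V b →
    bil v w' = sgn F a b • bil w' v
  bil_alt : ∀ v : V, v ∈ gr F V 1 → bil v v = 0

/-- `W`, with data `d`, is (a realization of) the universal quadratic functor `Γ(V)`. -/
def IsGamma (F : Type u) (V : Type v) (W : Type w) [Field F]
    [AddCommGroup V] [Module F V] [SuperModule F V] [AddCommGroup W] [Module F W]
    (d : GammaData F V W) : Prop :=
  ∀ (W' : Type (max u v w)) [AddCommGroup W'] [Module F W'] (d' : GammaData F V W'),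
    ∃! h : W →ₗ[F] W',
      (∀ v ∈ gr F V 0, h (d.gam v) = d'.gam v) ∧ (∀ v w' : V, h (d.bil v w') = d'.bil v w')

/-- `Fr` is a free Lie superalgebra on the graded set `(X, deg)` with inclusion `ι`. -/
def IsFreeLSA (F : Type u) (X : Type v) (deg : X → ZMod 2) (Fr : Type w) [Field F]
    [AddCommGroup Fr] [Module F Fr] [SuperModule F Fr] [LieSuperAlgebra F Fr]
    (ι : X → Fr) : Prop :=
  (∀ x : X, ι x ∈ gr F Fr (deg x)) ∧
  ∀ (K : Type (max u v w)) [AddCommGroup K] [Module F K] [SuperModule F K]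
    [LieSuperAlgebra F K] (f : X → K), (∀ x : X, f x ∈ gr F K (deg x)) →
    ∃! h : LieSuperHom F Fr K, ∀ x : X, h.toLinearMap (ι x) = f x

/-- Dimension of the degree-`a` part of the Schur multiplier `(R ∩ [Fr,Fr])/[Fr,R]`
attached to a free presentation with kernel `R`. -/
noncomputable def schurDim (F : Type u) (Fr : Type v) [Field F] [AddCommGroup Fr]
    [Module F Fr] [SuperModule F Fr] [LieSuperAlgebra F Fr]
    (R : Submodule F Fr) (a : ZMod 2) : ℕ :=
  finrank F ((R ⊓ derivedSub F Fr ⊓ gr F Fr a).map (bracketSub F Fr ⊤ R).mkQ)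

/-- `L` is (isomorphic to) the Heisenberg Lie superalgebra `H(m, n)` with even center:
it admits a homogeneous basis `x₁,…,x_{2m}, y₁,…,y_n, z` with the defining brackets. -/
def IsHmn (F : Type u) (m n : ℕ) (L : Type v) [Field F]
    [AddCommGroup L] [Module F L] [SuperModule F L] [LieSuperAlgebra F L] : Prop :=
  ∃ (xv : Fin (2 * m) → L) (yv : Fin n → L) (zv : L)
    (B : Basis ((Fin (2 * m)) ⊕ (Fin n) ⊕ Unit) F L),
    (∀ i, B (Sum.inl i) = xv i) ∧ (∀ j, B (Sum.inr (Sum.inl j)) = yv j) ∧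
    B (Sum.inr (Sum.inr ())) = zv ∧
    (∀ i, xv i ∈ gr F L 0) ∧ (∀ j, yv j ∈ gr F L 1) ∧ zv ∈ gr F L 0 ∧
    (∀ i j : Fin (2 * m), br F L (xv i) (xv j) =
      if (j : ℕ) = (i : ℕ) + m then zv else if (i : ℕ) = (j : ℕ) + m then -zv else 0) ∧
    (∀ (i : Fin (2 * m)) (j : Fin n), br F L (xv i) (yv j) = 0) ∧
    (∀ (j : Fin n) (i : Fin (2 * m)), br F L (yv j) (xv i) = 0) ∧
    (∀ j k : Fin n, br F L (yv j) (yv k) = if j = k then zv else 0) ∧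
    (∀ i, br F L (xv i) zv = 0) ∧ (∀ i, br F L zv (xv i) = 0) ∧
    (∀ j, br F L (yv j) zv = 0) ∧ (∀ j, br F L zv (yv j) = 0) ∧
    br F L zv zv = 0

/-- `L` is (isomorphic to) the Heisenberg Lie superalgebra `H_m` with odd center. -/
def IsHmOdd (F : Type u) (m : ℕ) (L : Type v) [Field F]
    [AddCommGroup L] [Module F L] [SuperModule F L] [LieSuperAlgebra F L] : Prop :=
  ∃ (xv yv : Fin m → L) (zv : L) (B : Basis ((Fin m) ⊕ (Fin m) ⊕ Unit) F L),
    (∀ i, B (Sum.inl i) = xv i) ∧ (∀ j, B (Sum.inr (Sum.inl j)) = yv j) ∧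
    B (Sum.inr (Sum.inr ())) = zv ∧
    (∀ i, xv i ∈ gr F L 0) ∧ (∀ j, yv j ∈ gr F L 1) ∧ zv ∈ gr F L 1 ∧
    (∀ i j, br F L (xv i) (xv j) = 0) ∧
    (∀ i j, br F L (xv i) (yv j) = if i = j then zv else 0) ∧
    (∀ i j, br F L (yv i) (xv j) = if i = j then -zv else 0) ∧
    (∀ i j, br F L (yv i) (yv j) = 0) ∧
    (∀ i, br F L (xv i) zv = 0) ∧ (∀ i, br F L zv (xv i) = 0) ∧
    (∀ j, br F L (yv j) zv = 0) ∧ (∀ j, br F L zv (yv j) = 0) ∧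
    br F L zv zv = 0

/-- `A` is (isomorphic to) the abelian Lie superalgebra `A(a | b)`. -/
def IsAbelianOfDim (F : Type u) (a b : ℕ) (A : Type v) [Field F]
    [AddCommGroup A] [Module F A] [SuperModule F A] [LieSuperAlgebra F A] : Prop :=
  IsAbelianLSA F A ∧ finrank F (gr F A 0) = a ∧ finrank F (gr F A 1) = b

/-- Heisenberg Lie superalgebra with even center: `Z(L) = L²` is one-dimensional,
spanned by a nonzero even element. -/
def IsHeisenbergEven (F : Type u) (L : Type v) [Field F]
    [AddCommGroup L] [Module F L] [SuperModule F L] [LieSuperAlgebra F L] : Prop :=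
  centerSub F L = derivedSub F L ∧
  ∃ zc : L, zc ≠ 0 ∧ zc ∈ gr F L 0 ∧ centerSub F L = Submodule.span F {zc}

/-- Heisenberg Lie superalgebra with odd center. -/
def IsHeisenbergOdd (F : Type u) (L : Type v) [Field F]
    [AddCommGroup L] [Module F L] [SuperModule F L] [LieSuperAlgebra F L] : Prop :=
  centerSub F L = derivedSub F L ∧
  ∃ zc : L, zc ≠ 0 ∧ zc ∈ gr F L 1 ∧ centerSub F L = Submodule.span F {zc}

/-- `P ≅ L ⊕ M` as Lie superalgebras (internal direct sum of two commuting copies). -/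
def IsDirectSumOf (F : Type u) (P : Type v) (L : Type w) (M : Type x) [Field F]
    [AddCommGroup P] [Module F P] [SuperModule F P] [LieSuperAlgebra F P]
    [AddCommGroup L] [Module F L] [SuperModule F L] [LieSuperAlgebra F L]
    [AddCommGroup M] [Module F M] [SuperModule F M] [LieSuperAlgebra F M] : Prop :=
  ∃ (f : LieSuperHom F L P) (g : LieSuperHom F M P),
    Function.Bijective (fun q : L × M => f.toLinearMap q.1 + g.toLinearMap q.2) ∧
    (∀ (x : L) (y : M), br F P (f.toLinearMap x) (g.toLinearMap y) = 0) ∧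
    (∀ (y : M) (x : L), br F P (g.toLinearMap y) (f.toLinearMap x) = 0)

/-- `S ≅ A ⊕ B ⊕ C ⊕ D` as Lie superalgebras. -/
def IsDirectSumOf4 (F : Type u) (S : Type v) (A : Type w) (B : Type x) (C : Type y)
    (D : Type z) [Field F]
    [AddCommGroup S] [Module F S] [SuperModule F S] [LieSuperAlgebra F S]
    [AddCommGroup A] [Module F A] [SuperModule F A] [LieSuperAlgebra F A]
    [AddCommGroup B] [Module F B] [SuperModule F B] [LieSuperAlgebra F B]
    [AddCommGroup C] [Module F C] [SuperModule F C] [LieSuperAlgebra F C]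
    [AddCommGroup D] [Module F D] [SuperModule F D] [LieSuperAlgebra F D] : Prop :=
  ∃ (f : LieSuperHom F A S) (g : LieSuperHom F B S) (h : LieSuperHom F C S)
    (k : LieSuperHom F D S),
    Function.Bijective (fun q : A × B × C × D =>
      f.toLinearMap q.1 + g.toLinearMap q.2.1 + h.toLinearMap q.2.2.1
        + k.toLinearMap q.2.2.2) ∧
    (∀ u v', br F S (f.toLinearMap u) (g.toLinearMap v') = 0) ∧
    (∀ u v', br F S (f.toLinearMap u) (h.toLinearMap v') = 0) ∧
    (∀ u v', br F S (f.toLinearMap u) (k.toLinearMap v') = 0) ∧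
    (∀ u v', br F S (g.toLinearMap u) (h.toLinearMap v') = 0) ∧
    (∀ u v', br F S (g.toLinearMap u) (k.toLinearMap v') = 0) ∧
    (∀ u v', br F S (h.toLinearMap u) (k.toLinearMap v') = 0)

/-- `L ≅ H(m, n) ⊕ A(a | b)`: an internal decomposition into a Heisenberg part with
even center, spanned by homogeneous elements with the defining brackets, and a central
abelian graded complement of dimension `(a | b)`. -/
def DecompHeisenbergAbelian (F : Type u) (L : Type v) [Field F]
    [AddCommGroup L] [Module F L] [SuperModule F L] [LieSuperAlgebra F L]
    (m n a b : ℕ) : Prop :=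
  ∃ (xv : Fin (2 * m) → L) (yv : Fin n → L) (zv : L) (A : Submodule F L),
    (∀ i, xv i ∈ gr F L 0) ∧ (∀ j, yv j ∈ gr F L 1) ∧ zv ∈ gr F L 0 ∧
    IsGradedSub F A ∧
    finrank F (A ⊓ gr F L 0 : Submodule F L) = a ∧
    finrank F (A ⊓ gr F L 1 : Submodule F L) = b ∧
    (∀ u ∈ A, ∀ v : L, br F L u v = 0 ∧ br F L v u = 0) ∧
    LinearIndependent F (Sum.elim xv (Sum.elim yv (fun _ : Unit => zv))) ∧
    Disjoint (Submodule.span F (Set.range (Sum.elim xv (Sum.elim yv (fun _ : Unit => zv))))) A ∧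
    Submodule.span F (Set.range (Sum.elim xv (Sum.elim yv (fun _ : Unit => zv)))) ⊔ A = ⊤ ∧
    (∀ i j : Fin (2 * m), br F L (xv i) (xv j) =
      if (j : ℕ) = (i : ℕ) + m then zv else if (i : ℕ) = (j : ℕ) + m then -zv else 0) ∧
    (∀ (i : Fin (2 * m)) (j : Fin n), br F L (xv i) (yv j) = 0) ∧
    (∀ (j : Fin n) (i : Fin (2 * m)), br F L (yv j) (xv i) = 0) ∧
    (∀ j k : Fin n, br F L (yv j) (yv k) = if j = k then zv else 0) ∧
    (∀ i, br F L (xv i) zv = 0) ∧ (∀ i, br F L zv (xv i) = 0) ∧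
    (∀ j, br F L (yv j) zv = 0) ∧ (∀ j, br F L zv (yv j) = 0) ∧
    br F L zv zv = 0

/-- The submodule of a realization of `I ⊗ J` (for graded ideals `I, J` of `M`)
generated by `x ⊗ y + (-1)^(|x||y|) y ⊗ x` and `x₀ ⊗ x₀` for `x, y, x₀ ∈ I ∩ J`,
`x₀` even. -/
def pairBox (F : Type u) (I : Type v) (J : Type w) (TIJ : Type x) (M : Type y) [Field F]
    [AddCommGroup I] [Module F I] [SuperModule F I] [LieSuperAlgebra F I]
    [AddCommGroup J] [Module F J] [SuperModule F J] [LieSuperAlgebra F J]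
    [AddCommGroup TIJ] [Module F TIJ] [SuperModule F TIJ] [LieSuperAlgebra F TIJ]
    [AddCommGroup M] [Module F M] [SuperModule F M] [LieSuperAlgebra F M]
    (ι : LieSuperHom F I M) (κ : LieSuperHom F J M)
    (α : LieSuperAction F I J) (β : LieSuperAction F J I)
    (p : SuperPairing F I J TIJ α β) : Submodule F TIJ :=
  Submodule.span F
    ({t | ∃ (a b : ZMod 2) (i i' : I) (j j' : J),
        ι.toLinearMap i = κ.toLinearMap j ∧ ι.toLinearMap i' = κ.toLinearMap j' ∧
        ι.toLinearMap i ∈ gr F M a ∧ ι.toLinearMap i' ∈ gr F M b ∧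
        t = p.pair i j' + sgn F a b • p.pair i' j} ∪
      {t | ∃ (i : I) (j : J), ι.toLinearMap i = κ.toLinearMap j ∧
        ι.toLinearMap i ∈ gr F M 0 ∧ t = p.pair i j})

section Helpers

theorem hx_decomp (F : Type u) {V : Type v} [Field F] [AddCommGroup V] [Module F V]
    [SuperModule F V] (x : V) : ∃ x0 ∈ gr F V 0, ∃ x1 ∈ gr F V 1, x0 + x1 = x :=
  Submodule.mem_sup.1 (by
    rw [(SuperModule.isCompl_grade (F := F) (V := V)).sup_eq_top]; trivial)

theorem hx_uniq (F : Type u) {V : Type v} [Field F] [AddCommGroup V] [Module F V]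
    [SuperModule F V] {x0 x1 : V} (h0 : x0 ∈ gr F V 0) (h1 : x1 ∈ gr F V 1)
    (h : x0 + x1 = 0) : x0 = 0 ∧ x1 = 0 := by
  have hd := (SuperModule.isCompl_grade (F := F) (V := V)).disjoint
  have e : x0 = -x1 := eq_neg_of_add_eq_zero_left h
  have : x0 = 0 := Submodule.disjoint_def.1 hd x0 h0 (by rw [e]; exact neg_mem h1)
  refine ⟨this, ?_⟩
  rw [this, zero_add] at h
  exact h

@[elab_as_elim]
theorem hx_ind (F : Type u) {V : Type v} [Field F] [AddCommGroup V] [Module F V]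
    [SuperModule F V] {P : V → Prop} (h : ∀ a, ∀ x ∈ gr F V a, P x)
    (ha : ∀ x y, P x → P y → P (x + y)) (x : V) : P x := by
  obtain ⟨x0, h0, x1, h1, rfl⟩ := hx_decomp F x
  exact ha _ _ (h _ _ h0) (h _ _ h1)

theorem hx_zmod2 (a : ZMod 2) : a = 0 ∨ a = 1 := by
  revert a; decide

theorem hx_sub {F : Type u} {R : Type v} {T : Type w} [Field F] [AddCommGroup R] [Module F R]
    [AddCommGroup T] [Module F T] [SuperModule F T] [LieSuperAlgebra F T]
    (i : R →ₗ[F] T) (hi : Function.Injective i)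
    (hg : ∀ r : R, ∃ r0 r1 : R, i r0 ∈ gr F T 0 ∧ i r1 ∈ gr F T 1 ∧ r0 + r1 = r)
    (hb : ∀ r s : R, br F T (i r) (i s) ∈ LinearMap.range i) :
    ∃ (_ : SuperModule F R) (_ : LieSuperAlgebra F R),
      (∀ a r, r ∈ gr F R a ↔ i r ∈ gr F T a) ∧
      ∀ r s, i (br F R r s) = br F T (i r) (i s) := by
  obtain ⟨l, hl⟩ := i.exists_leftInverse_of_injective (LinearMap.ker_eq_bot.2 hi)
  have hl' : ∀ r, l (i r) = r := fun r => LinearMap.congr_fun hl r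
  let s : SuperModule F R :=
    { grade := fun a => (gr F T a).comap i
      isCompl_grade := by
        constructor
        · rw [Submodule.disjoint_def]
          intro x h0 h1
          apply hi
          rw [map_zero]
          exact Submodule.disjoint_def.1
            (SuperModule.isCompl_grade (F := F) (V := T)).disjoint _ h0 h1
        · rw [codisjoint_iff, eq_top_iff]
          intro r _
          obtain ⟨r0, r1, h0, h1, e⟩ := hg r
          exact Submodule.mem_sup.2 ⟨r0, h0, r1, h1, e⟩ }
  let b : R →ₗ[F] R →ₗ[F] R := ((br F T).compl₁₂ i i).compr₂ l
  have hbb : ∀ r s, i (b r s) = br F T (i r) (i s) := by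
    intro r s
    obtain ⟨t, ht⟩ := hb r s
    show i (l (br F T (i r) (i s))) = _
    rw [← ht, hl']
  have hgr : ∀ a r, r ∈ gr F R a ↔ i r ∈ gr F T a := fun a r => Iff.rfl
  let la : LieSuperAlgebra F R :=
    { bracket := b
      bracket_grade := by
        intro a c x y hx hy
        rw [hgr] at *
        rw [hbb]
        exact LieSuperAlgebra.bracket_grade a c _ _ hx hy
      skew := by
        intro a c x y hx hy
        rw [hgr] at *
        apply hi
        rw [map_smul, hbb, hbb]
        exact LieSuperAlgebra.skew a c _ _ hx hy
      jacobi := by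
        intro a c d x y z hx hy hz
        rw [hgr] at *
        apply hi
        simp only [map_add, map_smul, hbb, map_zero]
        exact LieSuperAlgebra.jacobi a c d _ _ _ hx hy hz }
  exact ⟨s, la, hgr, hbb⟩

theorem hx_quot {F : Type u} {R : Type v} {T : Type w} [Field F] [AddCommGroup R] [Module F R]
    [AddCommGroup T] [Module F T] [SuperModule F T] [LieSuperAlgebra F T]
    (φ : T →ₗ[F] R) (hφ : Function.Surjective φ)
    (hg : ∀ t0 t1 : T, t0 ∈ gr F T 0 → t1 ∈ gr F T 1 → φ (t0 + t1) = 0 → φ t0 = 0)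
    (hb : ∀ r s : T, φ r = 0 → φ (br F T r s) = 0)
    (hb' : ∀ r s : T, φ s = 0 → φ (br F T r s) = 0) :
    ∃ (_ : SuperModule F R) (_ : LieSuperAlgebra F R),
      (∀ a r, r ∈ gr F R a ↔ ∃ t ∈ gr F T a, φ t = r) ∧
      ∀ r s, φ (br F T r s) = br F R (φ r) (φ s) := by
  obtain ⟨l, hl⟩ := φ.exists_rightInverse_of_surjective (LinearMap.range_eq_top.2 hφ)
  have hl' : ∀ r, φ (l r) = r := fun r => LinearMap.congr_fun hl r
  let s : SuperModule F R :=
    { grade := fun a => (gr F T a).map φ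
      isCompl_grade := by
        constructor
        · rw [Submodule.disjoint_def]
          rintro x ⟨t0, h0, rfl⟩ ⟨t1, h1, h⟩
          refine hg t0 (-t1) h0 (neg_mem h1) ?_
          rw [map_add, map_neg, h, add_neg_cancel]
        · rw [codisjoint_iff, ← Submodule.map_sup,
            (SuperModule.isCompl_grade (F := F) (V := T)).sup_eq_top, Submodule.map_top,
            LinearMap.range_eq_top.2 hφ] }
  let b : R →ₗ[F] R →ₗ[F] R := ((br F T).compl₁₂ l l).compr₂ φ
  have hbb : ∀ r s, φ (br F T r s) = b (φ r) (φ s) := by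
    intro r s
    show _ = φ (br F T (l (φ r)) (l (φ s)))
    have e1 : φ (br F T (r - l (φ r)) s) = 0 := hb _ _ (by rw [map_sub, hl', sub_self])
    have e2 : φ (br F T (l (φ r)) (s - l (φ s))) = 0 := hb' _ _ (by rw [map_sub, hl', sub_self])
    simp only [map_sub, LinearMap.sub_apply] at e1 e2
    rw [sub_eq_zero.1 e1, sub_eq_zero.1 e2]
  have hgr : ∀ a r, r ∈ gr F R a ↔ ∃ t ∈ gr F T a, φ t = r := fun a r => Iff.rfl
  let la : LieSuperAlgebra F R :=
    { bracket := b
      bracket_grade := by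
        rintro a c x y ⟨x, hx, rfl⟩ ⟨y, hy, rfl⟩
        rw [← hbb]
        exact ⟨_, LieSuperAlgebra.bracket_grade a c _ _ hx hy, rfl⟩
      skew := by
        rintro a c x y ⟨x, hx, rfl⟩ ⟨y, hy, rfl⟩
        rw [← hbb, ← hbb, ← map_smul]
        exact congrArg φ (LieSuperAlgebra.skew a c _ _ hx hy)
      jacobi := by
        rintro a c d x y z ⟨x, hx, rfl⟩ ⟨y, hy, rfl⟩ ⟨z, hz, rfl⟩
        have hj := congrArg φ (LieSuperAlgebra.jacobi a c d _ _ _ hx hy hz)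
        simp only [map_add, map_smul, map_zero] at hj
        simp only [← hbb]
        exact hj }
  exact ⟨s, la, hgr, hbb⟩

theorem hx_pull {F : Type u} {M : Type v} {N : Type w} {T : Type x} {R : Type y} [Field F]
    [AddCommGroup M] [Module F M] [SuperModule F M] [LieSuperAlgebra F M]
    [AddCommGroup N] [Module F N] [SuperModule F N] [LieSuperAlgebra F N]
    [AddCommGroup T] [Module F T] [SuperModule F T] [LieSuperAlgebra F T]
    {α : LieSuperAction F M N} {β : LieSuperAction F N M}
    (q : SuperPairing F M N T α β) [AddCommGroup R] [Module F R]
    (i : R →ₗ[F] T) (hi : Function.Injective i)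
    (hg : ∀ r : R, ∃ r0 r1 : R, i r0 ∈ gr F T 0 ∧ i r1 ∈ gr F T 1 ∧ r0 + r1 = r)
    (hb : ∀ r s : R, br F T (i r) (i s) ∈ LinearMap.range i)
    (hq : ∀ m n, q.pair m n ∈ LinearMap.range i) :
    ∃ (_ : SuperModule F R) (_ : LieSuperAlgebra F R) (q' : SuperPairing F M N R α β)
      (j : LieSuperHom F R T), j.toLinearMap = i ∧ (∀ m n, i (q'.pair m n) = q.pair m n) ∧
      (∀ a r, r ∈ gr F R a ↔ i r ∈ gr F T a) := by
  obtain ⟨l, hl⟩ := i.exists_leftInverse_of_injective (LinearMap.ker_eq_bot.2 hi)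
  have hl' : ∀ r, l (i r) = r := fun r => LinearMap.congr_fun hl r
  obtain ⟨s, la, hgr, hbb⟩ := hx_sub i hi hg hb
  let p : M →ₗ[F] N →ₗ[F] R := q.pair.compr₂ l
  have hp : ∀ m n, i (p m n) = q.pair m n := by
    intro r s
    obtain ⟨t, ht⟩ := hq r s
    show i (l (q.pair r s)) = _
    rw [← ht, hl']
  refine ⟨s, la, ⟨p, ?_, ?_, ?_, ?_⟩, ⟨i, fun a x h => (hgr a x).1 h, hbb⟩, rfl, hp, hgr⟩
  · intro a b m n hm hn
    rw [hgr, hp]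
    exact q.pair_grade a b m n hm hn
  · intro a b m m' n hm hm'
    apply hi
    simp only [map_sub, map_smul, hp]
    exact q.rel1 a b m m' n hm hm'
  · intro a b c m n n' hm hn hn'
    apply hi
    simp only [map_sub, map_smul, hp]
    exact q.rel2 a b c m n n' hm hn hn'
  · intro a b m n m' n' hm hn
    apply hi
    simp only [map_smul, hp, hbb]
    exact q.rel3 a b m n m' n' hm hn

theorem hx_small {F : Type u} {M : Type v} {N : Type w} {T : Type x} [Field F]
    [AddCommGroup M] [Module F M] [SuperModule F M] [LieSuperAlgebra F M]
    [AddCommGroup N] [Module F N] [SuperModule F N] [LieSuperAlgebra F N]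
    [AddCommGroup T] [Module F T] [SuperModule F T] [LieSuperAlgebra F T]
    {α : LieSuperAction F M N} {β : LieSuperAction F N M}
    (q : SuperPairing F M N T α β) :
    ∃ (R : Type (max u v w z)) (_ : AddCommGroup R) (_ : Module F R)
      (_ : SuperModule F R) (_ : LieSuperAlgebra F R) (q' : SuperPairing F M N R α β)
      (j : LieSuperHom F R T), (∀ m n, j.toLinearMap (q'.pair m n) = q.pair m n) ∧
      LinearMap.range j.toLinearMap = LinearMap.range (TensorProduct.lift q.pair) := by
  let S := LinearMap.range (TensorProduct.lift q.pair)
  have hqS : ∀ m n, q.pair m n ∈ S := fun m n => ⟨m ⊗ₜ n, by simp⟩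
  have : Small.{max u v w z} (M ⊗[F] N) := ⟨ULift.{max u z} _, ⟨Equiv.ulift.symm⟩⟩
  have : Small.{max u v w z} S :=
    small_of_surjective (LinearMap.surjective_rangeRestrict (TensorProduct.lift q.pair))
  let e : Shrink.{max u v w z} S ≃ₗ[F] S := Shrink.linearEquiv F S
  let i : Shrink.{max u v w z} S →ₗ[F] T := S.subtype ∘ₗ e.toLinearMap
  have hi : Function.Injective i := S.injective_subtype.comp e.injective
  have hir : LinearMap.range i = S := by
    rw [LinearMap.range_comp, LinearEquiv.range, Submodule.map_top, Submodule.range_subtype]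
  have hSg : ∀ t ∈ S, ∃ t0 ∈ S, ∃ t1 ∈ S, t0 ∈ gr F T 0 ∧ t1 ∈ gr F T 1 ∧ t0 + t1 = t := by
    rintro _ ⟨t, rfl⟩
    have key : ∀ t : M ⊗[F] N, ∃ t0 ∈ S, ∃ t1 ∈ S, t0 ∈ gr F T 0 ∧ t1 ∈ gr F T 1 ∧
        t0 + t1 = TensorProduct.lift q.pair t := by
      intro t
      have hadd : ∀ x y : T, (∃ t0 ∈ S, ∃ t1 ∈ S, t0 ∈ gr F T 0 ∧ t1 ∈ gr F T 1 ∧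
        t0 + t1 = x) → (∃ t0 ∈ S, ∃ t1 ∈ S, t0 ∈ gr F T 0 ∧ t1 ∈ gr F T 1 ∧
        t0 + t1 = y) → (∃ t0 ∈ S, ∃ t1 ∈ S, t0 ∈ gr F T 0 ∧ t1 ∈ gr F T 1 ∧
        t0 + t1 = x + y) := by
        rintro x y ⟨a0, s0, a1, s1, g0, g1, rfl⟩ ⟨b0, s0', b1, s1', g0', g1', rfl⟩
        exact ⟨a0 + b0, add_mem s0 s0', a1 + b1, add_mem s1 s1', add_mem g0 g0', add_mem g1 g1',
          by abel⟩
      induction t with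
      | zero => exact ⟨0, zero_mem _, 0, zero_mem _, zero_mem _, zero_mem _, by simp⟩
      | add x y hx hy => rw [map_add]; exact hadd _ _ hx hy
      | tmul m n =>
        rw [TensorProduct.lift.tmul]
        revert n
        refine hx_ind F (fun a m hm => ?_) (fun m m' h h' n => ?_) m
        · intro n
          refine hx_ind F (fun b n hn => ?_) (fun n n' h h' => ?_) n
          · have := q.pair_grade a b m n hm hn
            rcases hx_zmod2 (a + b) with h | h <;> rw [h] at this
            · exact ⟨_, hqS m n, 0, zero_mem _, this, zero_mem _, add_zero _⟩
            · exact ⟨0, zero_mem _, _, hqS m n, zero_mem _, this, zero_add _⟩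
          · rw [map_add]; exact hadd _ _ h h'
        · rw [map_add, LinearMap.add_apply]; exact hadd _ _ (h n) (h' n)
    exact key t
  have hSb : ∀ s ∈ S, ∀ t ∈ S, br F T s t ∈ S := by
    rintro _ ⟨s, rfl⟩ _ ⟨t, rfl⟩
    induction s with
    | zero => simp
    | add x y hx hy => simp only [map_add, LinearMap.add_apply]; exact add_mem hx hy
    | tmul m n =>
      induction t with
      | zero => simp
      | add x y hx hy => simp only [map_add]; exact add_mem hx hy
      | tmul m' n' =>
        simp only [TensorProduct.lift.tmul]
        revert n
        refine hx_ind F (fun a m hm => ?_) (fun m₁ m₂ h h' n => ?_) m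
        · intro n
          refine hx_ind F (fun b n hn => ?_) (fun n₁ n₂ h h' => ?_) n
          · rw [q.rel3 a b m n m' n' hm hn]
            exact S.smul_mem _ (hqS _ _)
          · simp only [map_add, LinearMap.add_apply]; exact add_mem h h'
        · simp only [map_add, LinearMap.add_apply]; exact add_mem (h n) (h' n)
  have hiS : ∀ r, i r ∈ S := fun r => (e r).2
  obtain ⟨s, la, q', j, hj, hq', -⟩ := hx_pull q i hi
    (by
      intro r
      obtain ⟨t0, s0, t1, s1, g0, g1, e⟩ := hSg (i r) (hiS r)
      rw [← hir] at s0 s1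
      obtain ⟨r0, rfl⟩ := s0
      obtain ⟨r1, rfl⟩ := s1
      exact ⟨r0, r1, g0, g1, hi (by rw [map_add, e])⟩)
    (by intro r s; rw [hir]; exact hSb _ (hiS r) _ (hiS s))
    (by intro m n; rw [hir]; exact hqS m n)
  refine ⟨_, _, _, s, la, q', j, ?_, ?_⟩
  · rw [hj]; exact hq'
  · rw [hj]; exact hir

/-- Composition of homomorphisms. -/
def hxComp {F : Type u} {L : Type v} {M : Type w} {K : Type x} [Field F]
    [AddCommGroup L] [Module F L] [SuperModule F L] [LieSuperAlgebra F L]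
    [AddCommGroup M] [Module F M] [SuperModule F M] [LieSuperAlgebra F M]
    [AddCommGroup K] [Module F K] [SuperModule F K] [LieSuperAlgebra F K]
    (g : LieSuperHom F M K) (f : LieSuperHom F L M) : LieSuperHom F L K where
  toLinearMap := g.toLinearMap ∘ₗ f.toLinearMap
  map_grade := fun a x h => g.map_grade a _ (f.map_grade a x h)
  map_bracket := fun x y => by simp [f.map_bracket, g.map_bracket]

theorem hx_lift {F : Type u} {M : Type v} {N : Type w} {T : Type x} {T' : Type y} [Field F]
    [AddCommGroup M] [Module F M] [SuperModule F M] [LieSuperAlgebra F M]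
    [AddCommGroup N] [Module F N] [SuperModule F N] [LieSuperAlgebra F N]
    [AddCommGroup T] [Module F T] [SuperModule F T] [LieSuperAlgebra F T]
    [AddCommGroup T'] [Module F T'] [SuperModule F T'] [LieSuperAlgebra F T']
    {α : LieSuperAction F M N} {β : LieSuperAction F N M}
    (p : SuperPairing F M N T α β) (hp : IsTensorProductLSA F M N T α β p)
    (q : SuperPairing F M N T' α β) :
    ∃ h : LieSuperHom F T T', (∀ m n, h.toLinearMap (p.pair m n) = q.pair m n) ∧
      LinearMap.range h.toLinearMap ≤ LinearMap.range (TensorProduct.lift q.pair) := by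
  obtain ⟨R, _, _, _, _, q', j, hj, hr⟩ := hx_small.{u, v, w, y, x} q
  obtain ⟨h, hh, -⟩ := hp R q'
  refine ⟨hxComp j h, fun m n => ?_, ?_⟩
  · show j.toLinearMap (h.toLinearMap _) = _
    rw [hh, hj]
  · rw [← hr]
    exact LinearMap.range_comp_le_range _ _

theorem hx_span {F : Type u} {M : Type v} {N : Type w} {T : Type x} [Field F]
    [AddCommGroup M] [Module F M] [SuperModule F M] [LieSuperAlgebra F M]
    [AddCommGroup N] [Module F N] [SuperModule F N] [LieSuperAlgebra F N]
    [AddCommGroup T] [Module F T] [SuperModule F T] [LieSuperAlgebra F T]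
    {α : LieSuperAction F M N} {β : LieSuperAction F N M}
    (p : SuperPairing F M N T α β) (hp : IsTensorProductLSA F M N T α β p) :
    LinearMap.range (TensorProduct.lift p.pair) = ⊤ := by
  obtain ⟨h, hh, hr⟩ := hx_lift p hp p
  have : Small.{max u v w x} T := ⟨ULift.{max u v w} T, ⟨Equiv.ulift.symm⟩⟩
  let e : Shrink.{max u v w x} T ≃ₗ[F] T := Shrink.linearEquiv F T
  have hre : LinearMap.range e.toLinearMap = ⊤ := LinearEquiv.range e
  obtain ⟨s, la, q', j, hj, hq', hgr⟩ := hx_pull p e.toLinearMap e.injective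
    (by
      intro r
      obtain ⟨t0, h0, t1, h1, he⟩ := hx_decomp F (e r)
      refine ⟨e.symm t0, e.symm t1, by simpa using h0, by simpa using h1, ?_⟩
      rw [← map_add, he, e.symm_apply_apply])
    (by intro r s; rw [hre]; trivial)
    (by intro r s; rw [hre]; trivial)
  let k : LieSuperHom F T (Shrink.{max u v w x} T) :=
    { toLinearMap := e.symm.toLinearMap
      map_grade := by
        intro a t ht
        rw [hgr]
        simpa using ht
      map_bracket := by
        intro t t'
        apply e.injective
        have := j.map_bracket (e.symm t) (e.symm t')
        rw [hj] at this
        simp only [LinearEquiv.coe_coe, LinearEquiv.apply_symm_apply] at this ⊢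
        exact this.symm }
  have hk : ∀ t, k.toLinearMap t = e.symm t := fun t => rfl
  obtain ⟨h0, -, hu⟩ := hp (Shrink.{max u v w x} T) q'
  have hkp : ∀ m n, k.toLinearMap (p.pair m n) = q'.pair m n := by
    intro m n
    rw [hk, ← hq']
    simp
  have e1 := hu k hkp
  have e2 := hu (hxComp k h) (by
    intro m n
    show k.toLinearMap (h.toLinearMap _) = _
    rw [hh, hkp])
  rw [eq_top_iff]
  intro t _
  have e3 : k.toLinearMap t = k.toLinearMap (h.toLinearMap t) := by
    have := congrArg (fun f => f.toLinearMap t) (e1.trans e2.symm)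
    exact this
  have e4 : t = h.toLinearMap t := e.symm.injective e3
  rw [e4]
  exact hr ⟨t, rfl⟩

theorem hx_sgn_sq (F : Type u) [Field F] (a b : ZMod 2) : sgn F a b * sgn F a b = 1 := by
  unfold sgn; split_ifs <;> simp

theorem hx_leib {F : Type u} {L : Type v} [Field F]
    [AddCommGroup L] [Module F L] [SuperModule F L] [LieSuperAlgebra F L]
    (a b : ZMod 2) (x y z : L) (hx : x ∈ gr F L a) (hy : y ∈ gr F L b) :
    br F L x (br F L y z) = br F L (br F L x y) z + sgn F a b • br F L y (br F L x z) := by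
  refine hx_ind F (fun c z hz => ?_) (fun z z' h h' => ?_) z
  · have hj := LieSuperAlgebra.jacobi (F := F) a b c x y z hx hy hz
    have h1 := LieSuperAlgebra.skew (F := F) c a z x hz hx
    have h2 := LieSuperAlgebra.skew (F := F) c (a + b) z _ hz
      (LieSuperAlgebra.bracket_grade (F := F) a b x y hx hy)
    rw [h1, h2] at hj
    simp only [map_smul] at hj
    rcases hx_zmod2 a with rfl | rfl <;> rcases hx_zmod2 b with rfl | rfl <;>
      rcases hx_zmod2 c with rfl | rfl <;>
      simp [sgn, show (1 : ZMod 2) + 1 = 0 from rfl] at hj ⊢ <;>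
      first
      | linear_combination (norm := module) hj
      | linear_combination (norm := module) (-1 : F) • hj
  · simp only [map_add, h, h', smul_add]; abel

/-- The adjoint action. -/
def hxAd (F : Type u) (L : Type v) [Field F]
    [AddCommGroup L] [Module F L] [SuperModule F L] [LieSuperAlgebra F L] :
    LieSuperAction F L L where
  act := br F L
  act_grade := fun a b p m => LieSuperAlgebra.bracket_grade a b p m
  act_bracket := by
    intro a b p p' m hp hp'
    rw [hx_leib a b p p' m hp hp']; abel
  act_lie := fun a b p m m' hp hm => hx_leib a b p m m' hp hm

/-- Tensor square pairing as a pairing. -/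
def hxSq {F : Type u} {L : Type v} {T : Type w} [Field F]
    [AddCommGroup L] [Module F L] [SuperModule F L] [LieSuperAlgebra F L]
    [AddCommGroup T] [Module F T] [SuperModule F T] [LieSuperAlgebra F T]
    (p : TensorSqPairing F L T) : SuperPairing F L L T (hxAd F L) (hxAd F L) :=
  ⟨p.pair, p.pair_grade, p.rel1, p.rel2, p.rel3⟩

theorem hx_sq {F : Type u} {L : Type v} {T : Type w} [Field F]
    [AddCommGroup L] [Module F L] [SuperModule F L] [LieSuperAlgebra F L]
    [AddCommGroup T] [Module F T] [SuperModule F T] [LieSuperAlgebra F T]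
    (p : TensorSqPairing F L T) (h : IsTensorSquare F L T p) :
    IsTensorProductLSA F L L T (hxAd F L) (hxAd F L) (hxSq p) := by
  intro T' _ _ _ _ q
  exact h T' ⟨q.pair, q.pair_grade, q.rel1, q.rel2, q.rel3⟩

theorem hx_flip {F : Type u} {L : Type v} {T : Type w} [Field F]
    [AddCommGroup L] [Module F L] [SuperModule F L] [LieSuperAlgebra F L]
    [AddCommGroup T] [Module F T] [SuperModule F T] [LieSuperAlgebra F T]
    (p : TensorSqPairing F L T) (a b c : ZMod 2) (x y z : L) (hx : x ∈ gr F L a)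
    (hy : y ∈ gr F L b) (hz : z ∈ gr F L c) :
    p.pair x (br F L y z) = -sgn F a (b + c) • p.pair (br F L y z) x := by
  have r2 := p.rel2 a b c x y z hx hy hz
  have r1 := p.rel1 c a z x y hz hx
  have r1' := p.rel1 b a y x z hy hx
  have r := p.rel1 b c y z x hy hz
  have s1 := LieSuperAlgebra.skew (F := F) c b z y hz hy
  have s2 := LieSuperAlgebra.skew (F := F) c a z x hz hx
  have s3 := LieSuperAlgebra.skew (F := F) b a y x hy hx
  rw [r1, r1'] at r2
  rw [s1] at r2
  rw [s2, s3] at r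
  rw [r]
  simp only [map_smul] at r2 ⊢
  rcases hx_zmod2 a with rfl | rfl <;> rcases hx_zmod2 b with rfl | rfl <;>
      rcases hx_zmod2 c with rfl | rfl <;>
      simp [sgn, show (1 : ZMod 2) + 1 = 0 from rfl] at r2 ⊢ <;>
      first
      | linear_combination (norm := module) r2
      | linear_combination (norm := module) (-1 : F) • r2

theorem hx_flip' {F : Type u} {L : Type v} {T : Type w} [Field F]
    [AddCommGroup L] [Module F L] [SuperModule F L] [LieSuperAlgebra F L]
    [AddCommGroup T] [Module F T] [SuperModule F T] [LieSuperAlgebra F T]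
    (p : TensorSqPairing F L T) (a d : ZMod 2) (x n : L) (hx : x ∈ gr F L a)
    (hn : n ∈ gr F L d) (hd : n ∈ derivedSub F L) :
    p.pair x n = -sgn F a d • p.pair n x := by
  have key : ∀ n ∈ derivedSub F L, ∃ n0 ∈ gr F L 0, ∃ n1 ∈ gr F L 1, n0 + n1 = n ∧
      p.pair x n0 = -sgn F a 0 • p.pair n0 x ∧ p.pair x n1 = -sgn F a 1 • p.pair n1 x := by
    have hadd : ∀ n m, (∃ n0 ∈ gr F L 0, ∃ n1 ∈ gr F L 1, n0 + n1 = n ∧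
      p.pair x n0 = -sgn F a 0 • p.pair n0 x ∧ p.pair x n1 = -sgn F a 1 • p.pair n1 x) →
      (∃ n0 ∈ gr F L 0, ∃ n1 ∈ gr F L 1, n0 + n1 = m ∧
      p.pair x n0 = -sgn F a 0 • p.pair n0 x ∧ p.pair x n1 = -sgn F a 1 • p.pair n1 x) →
      (∃ n0 ∈ gr F L 0, ∃ n1 ∈ gr F L 1, n0 + n1 = n + m ∧
      p.pair x n0 = -sgn F a 0 • p.pair n0 x ∧ p.pair x n1 = -sgn F a 1 • p.pair n1 x) := by
      rintro _ _ ⟨n0, h0, n1, h1, rfl, e0, e1⟩ ⟨m0, k0, m1, k1, rfl, f0, f1⟩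
      refine ⟨n0 + m0, add_mem h0 k0, n1 + m1, add_mem h1 k1, by abel, ?_, ?_⟩
      · rw [map_add, e0, f0, map_add, LinearMap.add_apply, smul_add]
      · rw [map_add, e1, f1, map_add, LinearMap.add_apply, smul_add]
    intro n hn
    unfold derivedSub at hn
    induction hn using Submodule.span_induction with
    | zero => exact ⟨0, zero_mem _, 0, zero_mem _, by simp, by simp, by simp⟩
    | add n m _ _ h h' => exact hadd _ _ h h'
    | smul c n _ h =>
      obtain ⟨n0, h0, n1, h1, rfl, e0, e1⟩ := h
      refine ⟨c • n0, Submodule.smul_mem _ c h0, c • n1, Submodule.smul_mem _ c h1,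
        (smul_add _ _ _).symm, ?_, ?_⟩
      · rw [map_smul, e0, map_smul, LinearMap.smul_apply, smul_comm]
      · rw [map_smul, e1, map_smul, LinearMap.smul_apply, smul_comm]
    | mem n h =>
      obtain ⟨y, z, rfl⟩ := h
      revert z
      refine hx_ind F (fun b y hy => ?_) (fun m₁ m₂ h h' n => ?_) y
      · intro z
        refine hx_ind F (fun c z hz => ?_) (fun n₁ n₂ h h' => ?_) z
        · have h := hx_flip p a b c x y z hx hy hz
          have hg := LieSuperAlgebra.bracket_grade (F := F) b c y z hy hz
          rcases hx_zmod2 (b + c) with e | e <;> rw [e] at h hg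
          · exact ⟨_, hg, 0, zero_mem _, add_zero _, h, by simp⟩
          · exact ⟨0, zero_mem _, _, hg, zero_add _, by simp, h⟩
        · rw [map_add]; exact hadd _ _ h h'
      · rw [map_add, LinearMap.add_apply]; exact hadd _ _ (h n) (h' n)
  obtain ⟨n0, h0, n1, h1, rfl, e0, e1⟩ := key n hd
  rcases hx_zmod2 d with rfl | rfl
  · have hz : n1 = 0 := by
      have : n1 ∈ gr F L 0 := by
        have := sub_mem hn h0
        rwa [add_sub_cancel_left] at this
      exact Submodule.disjoint_def.1
        (SuperModule.isCompl_grade (F := F) (V := L)).disjoint _ this h1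
    rw [hz, add_zero]; exact e0
  · have hz : n0 = 0 := by
      have : n0 ∈ gr F L 1 := by
        have := sub_mem hn h1
        rwa [add_sub_cancel_right] at this
      exact Submodule.disjoint_def.1
        (SuperModule.isCompl_grade (F := F) (V := L)).disjoint _ h0 this
    rw [hz, zero_add]; exact e1

theorem hx_liftgr {F : Type u} {L : Type v} {Q : Type w} [Field F]
    [AddCommGroup L] [Module F L] [SuperModule F L] [LieSuperAlgebra F L]
    [AddCommGroup Q] [Module F Q] [SuperModule F Q] [LieSuperAlgebra F Q]
    (π : LieSuperHom F L Q) (hs : Function.Surjective π.toLinearMap) (a : ZMod 2) (q : Q)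
    (hq : q ∈ gr F Q a) : ∃ x ∈ gr F L a, π.toLinearMap x = q := by
  obtain ⟨x, rfl⟩ := hs q
  obtain ⟨x0, h0, x1, h1, rfl⟩ := hx_decomp F x
  have k0 := π.map_grade 0 x0 h0
  have k1 := π.map_grade 1 x1 h1
  rw [map_add] at hq
  rcases hx_zmod2 a with rfl | rfl
  · refine ⟨x0, h0, ?_⟩
    have : π.toLinearMap x1 ∈ gr F Q 0 := by
      have := sub_mem hq k0
      rwa [add_sub_cancel_left] at this
    rw [map_add, Submodule.disjoint_def.1
      (SuperModule.isCompl_grade (F := F) (V := Q)).disjoint _ this k1, add_zero]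
  · refine ⟨x1, h1, ?_⟩
    have : π.toLinearMap x0 ∈ gr F Q 1 := by
      have := sub_mem hq k1
      rwa [add_sub_cancel_right] at this
    rw [map_add, Submodule.disjoint_def.1
      (SuperModule.isCompl_grade (F := F) (V := Q)).disjoint _ k0 this, zero_add]

end Helpers

theorem stmt_8 (F : Type*) [Field F] (hchar2 : ringChar F ≠ 2) (hchar3 : ringChar F ≠ 3)
    (L : Type*) [AddCommGroup L] [Module F L] [SuperModule F L] [LieSuperAlgebra F L]
    (N : Type*) [AddCommGroup N] [Module F N] [SuperModule F N] [LieSuperAlgebra F N]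
    (ι : LieSuperHom F N L) (hinj : Function.Injective ι.toLinearMap)
    (hcent : LinearMap.range ι.toLinearMap ≤ derivedSub F L ⊓ centerSub F L)
    (hideal : ∀ (x : L) (u : N),
      br F L x (ι.toLinearMap u) ∈ LinearMap.range ι.toLinearMap)
    (T1 : Type*) [AddCommGroup T1] [Module F T1] [SuperModule F T1] [LieSuperAlgebra F T1]
    (p1 : SuperPairing F N L T1 (trivialAction F N L) (trivialAction F L N))
    (h1 : IsTensorProductLSA F N L T1 (trivialAction F N L) (trivialAction F L N) p1)
    (T2 : Type*) [AddCommGroup T2] [Module F T2] [SuperModule F T2] [LieSuperAlgebra F T2]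
    (p2 : TensorSqPairing F L T2) (h2 : IsTensorSquare F L T2 p2)
    (Q : Type*) [AddCommGroup Q] [Module F Q] [SuperModule F Q] [LieSuperAlgebra F Q]
    (π : LieSuperHom F L Q) (hπs : Function.Surjective π.toLinearMap)
    (hπk : LinearMap.ker π.toLinearMap = LinearMap.range ι.toLinearMap)
    (T3 : Type*) [AddCommGroup T3] [Module F T3] [SuperModule F T3] [LieSuperAlgebra F T3]
    (p3 : TensorSqPairing F Q T3) (h3 : IsTensorSquare F Q T3 p3) :
    ∃ (f : LieSuperHom F T1 T2) (g : LieSuperHom F T2 T3),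
      (∀ (u : N) (x : L), f.toLinearMap (p1.pair u x) = p2.pair (ι.toLinearMap u) x) ∧
      (∀ x y : L, g.toLinearMap (p2.pair x y)
        = p3.pair (π.toLinearMap x) (π.toLinearMap y)) ∧
      Function.Surjective g.toLinearMap ∧
      LinearMap.range f.toLinearMap = LinearMap.ker g.toLinearMap := by
  have hz : ∀ (u : N) (y : L), br F L (ι.toLinearMap u) y = 0 := by
    intro u y
    have h := (hcent ⟨u, rfl⟩ : ι.toLinearMap u ∈ derivedSub F L ⊓ centerSub F L).2
    unfold centerSub at h
    exact (Submodule.mem_iInf _).1 h y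
  have hz' : ∀ (u : N) (y : L), br F L y (ι.toLinearMap u) = 0 := by
    intro u y
    refine hx_ind F (fun a y hy => ?_) (fun y y' h h' => ?_) y
    · refine hx_ind F (fun b u hu => ?_) (fun u u' h h' => ?_) u
      · have := LieSuperAlgebra.skew (F := F) a b y _ hy (ι.map_grade b u hu)
        have h0 := hz u y
        unfold br at h0 ⊢
        rw [this, h0, smul_zero]
      · rw [map_add, map_add, h, h', add_zero]
    · rw [map_add, LinearMap.add_apply, h, h', add_zero]
  have hder : ∀ u, ι.toLinearMap u ∈ derivedSub F L := fun u =>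
    (hcent ⟨u, rfl⟩ : ι.toLinearMap u ∈ derivedSub F L ⊓ centerSub F L).1
  -- the first map
  let q1 : SuperPairing F N L T2 (trivialAction F N L) (trivialAction F L N) :=
    { pair := p2.pair ∘ₗ ι.toLinearMap
      pair_grade := fun a b m n hm hn => p2.pair_grade a b _ n (ι.map_grade a m hm) hn
      rel1 := by
        intro a b m m' n hm hm'
        simp [trivialAction, ι.map_bracket, hz]
      rel2 := by
        intro a b c m n n' hm hn hn'
        have := p2.rel2 a b c _ n n' (ι.map_grade a m hm) hn hn'
        simp only [hz'] at this
        simpa [trivialAction] using this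
      rel3 := by
        intro a b m n m' n' hm hn
        have := p2.rel3 a b _ n (ι.toLinearMap m') n' (ι.map_grade a m hm) hn
        simp only [hz'] at this
        simpa [trivialAction] using this }
  obtain ⟨f, hf, -⟩ := hx_lift p1 h1 q1
  have hf' : ∀ (u : N) (x : L), f.toLinearMap (p1.pair u x) = p2.pair (ι.toLinearMap u) x := hf
  -- the second map
  let q2 : TensorSqPairing F L T3 :=
    { pair := p3.pair.compl₁₂ π.toLinearMap π.toLinearMap
      pair_grade := fun a b m n hm hn =>
        p3.pair_grade a b _ _ (π.map_grade a m hm) (π.map_grade b n hn)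
      rel1 := by
        intro a b m m' n hm hm'
        simp only [LinearMap.compl₁₂_apply, π.map_bracket]
        exact p3.rel1 a b _ _ _ (π.map_grade a m hm) (π.map_grade b m' hm')
      rel2 := by
        intro a b c m n n' hm hn hn'
        simp only [LinearMap.compl₁₂_apply, π.map_bracket]
        exact p3.rel2 a b c _ _ _ (π.map_grade a m hm) (π.map_grade b n hn)
          (π.map_grade c n' hn')
      rel3 := by
        intro a b m n m' n' hm hn
        simp only [LinearMap.compl₁₂_apply, π.map_bracket]
        exact p3.rel3 a b _ _ _ _ (π.map_grade a m hm) (π.map_grade b n hn) }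
  obtain ⟨g, hg, -⟩ := hx_lift (hxSq p2) (hx_sq p2 h2) (hxSq q2)
  have hg' : ∀ x y : L, g.toLinearMap (p2.pair x y)
        = p3.pair (π.toLinearMap x) (π.toLinearMap y) := hg
  have sp1 := hx_span p1 h1
  have sp2 : LinearMap.range (TensorProduct.lift p2.pair) = ⊤ := hx_span (hxSq p2) (hx_sq p2 h2)
  have sp3 : LinearMap.range (TensorProduct.lift p3.pair) = ⊤ := hx_span (hxSq p3) (hx_sq p3 h3)
  have hπι : ∀ u, π.toLinearMap (ι.toLinearMap u) = 0 := fun u => by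
    have : ι.toLinearMap u ∈ LinearMap.ker π.toLinearMap := by rw [hπk]; exact ⟨u, rfl⟩
    exact this
  refine ⟨f, g, hf', hg', ?_, le_antisymm ?_ ?_⟩
  · rw [← LinearMap.range_eq_top, eq_top_iff, ← sp3]
    rintro _ ⟨t, rfl⟩
    induction t with
    | zero => simp
    | add x y hx hy => rw [map_add]; exact add_mem hx hy
    | tmul a b =>
      obtain ⟨a, rfl⟩ := hπs a
      obtain ⟨b, rfl⟩ := hπs b
      exact ⟨p2.pair a b, by rw [hg', TensorProduct.lift.tmul]⟩
  · rintro _ ⟨t, rfl⟩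
    have ht : t ∈ LinearMap.range (TensorProduct.lift p1.pair) := by rw [sp1]; trivial
    obtain ⟨t, rfl⟩ := ht
    induction t with
    | zero => simp
    | add x y hx hy => rw [map_add, map_add]; exact add_mem hx hy
    | tmul a b =>
      rw [TensorProduct.lift.tmul, hf', LinearMap.mem_ker, hg', hπι, map_zero,
        LinearMap.zero_apply]
  · -- the kernel of `g` lies in the range of `f`
    let I := LinearMap.range f.toLinearMap
    have hI1 : ∀ u x, p2.pair (ι.toLinearMap u) x ∈ I := fun u x => ⟨_, hf' u x⟩
    have hI2 : ∀ u x, p2.pair x (ι.toLinearMap u) ∈ I := by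
      intro u x
      refine hx_ind F (fun a x hx => ?_) (fun y y' h h' => ?_) x
      · refine hx_ind F (fun b u hu => ?_) (fun u u' h h' => ?_) u
        · rw [hx_flip' p2 a b x _ hx (ι.map_grade b u hu) (hder u)]
          exact I.smul_mem _ (hI1 u x)
        · rw [map_add, map_add]; exact add_mem h h'
      · rw [map_add, LinearMap.add_apply]; exact add_mem h h'
    have hc : ∀ s t, br F T2 (f.toLinearMap s) t = 0 := by
      intro s t
      have hs : s ∈ LinearMap.range (TensorProduct.lift p1.pair) := by rw [sp1]; trivial
      have ht : t ∈ LinearMap.range (TensorProduct.lift p2.pair) := by rw [sp2]; trivial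
      obtain ⟨s, rfl⟩ := hs
      obtain ⟨t, rfl⟩ := ht
      induction s with
      | zero => simp
      | add x y hx hy => simp only [map_add, LinearMap.add_apply, hx, hy, add_zero]
      | tmul m n =>
        induction t with
        | zero => simp
        | add x y hx hy => simp only [map_add, hx, hy, add_zero]
        | tmul m' n' =>
          simp only [TensorProduct.lift.tmul, hf']
          revert n
          refine hx_ind F (fun a m hm => ?_) (fun m₁ m₂ h h' n => ?_) m
          · intro n
            refine hx_ind F (fun b n hn => ?_) (fun n₁ n₂ h h' => ?_) n
            · rw [p2.rel3 a b _ n m' n' (ι.map_grade a m hm) hn, hz']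
              simp
            · simp only [map_add, LinearMap.add_apply, h, h', add_zero]
          · simp only [map_add, LinearMap.add_apply, h n, h' n, add_zero]
    have hc' : ∀ s t, br F T2 t (f.toLinearMap s) = 0 := by
      intro u y
      refine hx_ind F (fun a y hy => ?_) (fun y y' h h' => ?_) y
      · refine hx_ind F (fun b u hu => ?_) (fun u u' h h' => ?_) u
        · have := LieSuperAlgebra.skew (F := F) a b y _ hy (f.map_grade b u hu)
          have h0 := hc u y
          unfold br at h0 ⊢
          rw [this, h0, smul_zero]
        · rw [map_add, map_add, h, h', add_zero]
      · rw [map_add, LinearMap.add_apply, h, h', add_zero]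
    have hmk : ∀ t, I.mkQ t = 0 ↔ t ∈ I := fun t => by
      rw [← LinearMap.mem_ker, Submodule.ker_mkQ]
    obtain ⟨_, _, hgr, hbr⟩ := hx_quot I.mkQ I.mkQ_surjective
      (by
        intro t0 t1 h0 h1 h
        rw [hmk] at h ⊢
        obtain ⟨s, hs⟩ := h
        obtain ⟨s0, k0, s1, k1, rfl⟩ := hx_decomp F s
        rw [map_add] at hs
        have e := hx_uniq F (sub_mem (f.map_grade 0 s0 k0) h0) (sub_mem (f.map_grade 1 s1 k1) h1)
          (by rw [sub_add_sub_comm, hs, sub_self])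
        exact ⟨s0, sub_eq_zero.1 e.1⟩)
      (by
        intro r s h
        rw [hmk] at h
        obtain ⟨r, rfl⟩ := h
        rw [hc, map_zero])
      (by
        intro r s h
        rw [hmk] at h
        obtain ⟨s, rfl⟩ := h
        rw [hc', map_zero])
    obtain ⟨l, hl⟩ := π.toLinearMap.exists_rightInverse_of_surjective
      (LinearMap.range_eq_top.2 hπs)
    have hl' : ∀ r, π.toLinearMap (l r) = r := fun r => LinearMap.congr_fun hl r
    have hdiff : ∀ x, ∃ u, ι.toLinearMap u = x - l (π.toLinearMap x) := by
      intro x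
      have : x - l (π.toLinearMap x) ∈ LinearMap.ker π.toLinearMap := by
        rw [LinearMap.mem_ker, map_sub, hl', sub_self]
      rw [hπk] at this
      exact this
    let b : Q →ₗ[F] Q →ₗ[F] (T2 ⧸ I) := (p2.pair.compl₁₂ l l).compr₂ I.mkQ
    have hb : ∀ x y, b (π.toLinearMap x) (π.toLinearMap y) = I.mkQ (p2.pair x y) := by
      intro x y
      show I.mkQ (p2.pair (l (π.toLinearMap x)) (l (π.toLinearMap y))) = _
      obtain ⟨u, hu⟩ := hdiff x
      obtain ⟨v, hv⟩ := hdiff y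
      have e1 := (hmk _).2 (hI1 u y)
      have e2 := (hmk _).2 (hI2 v (l (π.toLinearMap x)))
      rw [hu] at e1
      rw [hv] at e2
      simp only [map_sub, LinearMap.sub_apply] at e1 e2
      rw [sub_eq_zero.1 e1, sub_eq_zero.1 e2]
    let q3 : TensorSqPairing F Q (T2 ⧸ I) :=
      { pair := b
        pair_grade := by
          intro a c x y hx hy
          obtain ⟨x, kx, rfl⟩ := hx_liftgr π hπs a x hx
          obtain ⟨y, ky, rfl⟩ := hx_liftgr π hπs c y hy
          rw [hb, hgr]
          exact ⟨_, p2.pair_grade a c x y kx ky, rfl⟩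
        rel1 := by
          intro a c x x' y hx hx'
          obtain ⟨x, kx, rfl⟩ := hx_liftgr π hπs a x hx
          obtain ⟨x', kx', rfl⟩ := hx_liftgr π hπs c x' hx'
          obtain ⟨y, rfl⟩ := hπs y
          simp only [← π.map_bracket, hb]
          rw [p2.rel1 a c x x' y kx kx', map_sub, map_smul]
        rel2 := by
          intro a c d x y y' hx hy hy'
          obtain ⟨x, kx, rfl⟩ := hx_liftgr π hπs a x hx
          obtain ⟨y, ky, rfl⟩ := hx_liftgr π hπs c y hy
          obtain ⟨y', ky', rfl⟩ := hx_liftgr π hπs d y' hy'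
          simp only [← π.map_bracket, hb]
          rw [p2.rel2 a c d x y y' kx ky ky', map_sub, map_smul, map_smul]
        rel3 := by
          intro a c x y x' y' hx hy
          obtain ⟨x, kx, rfl⟩ := hx_liftgr π hπs a x hx
          obtain ⟨y, ky, rfl⟩ := hx_liftgr π hπs c y hy
          obtain ⟨x', rfl⟩ := hπs x'
          obtain ⟨y', rfl⟩ := hπs y'
          simp only [← π.map_bracket, hb, ← hbr]
          rw [p2.rel3 a c x y x' y' kx ky, map_smul] }
    obtain ⟨k, hk, -⟩ := hx_lift (hxSq p3) (hx_sq p3 h3) (hxSq q3)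
    have hk' : ∀ x y, k.toLinearMap (p3.pair x y) = b x y := hk
    have hkg : ∀ t, k.toLinearMap (g.toLinearMap t) = I.mkQ t := by
      intro t
      have ht : t ∈ LinearMap.range (TensorProduct.lift p2.pair) := by rw [sp2]; trivial
      obtain ⟨t, rfl⟩ := ht
      induction t with
      | zero => simp
      | add x y hx hy => simp only [map_add, hx, hy]
      | tmul x y => rw [TensorProduct.lift.tmul, hg', hk', hb]
    intro t ht
    rw [LinearMap.mem_ker] at ht
    have := hkg t
    rw [ht, map_zero] at this
    exact (hmk t).1 this.symm
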